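/- Let n ≥ 1, 0 ≤ δ < 1 and a ∈ S^{-n}_{0,δ}. Fix an integer N_δ > 2n/(1−δ) + n and a real θ_0 with max{0, (n/2)(1−δ) − nN_δ/(N_δ−n)} < θ_0 < (n/2)(1−δ) − n²/(N_δ−n), and set T_δ = −n²/N_δ + (1 − n/N_δ)((n/2)(1−δ) − θ_0) (so T_δ > 0). There is a constant C such that for every 0 < l < 1, every x_0 ∈ ℝⁿ, every positive integer j with 2^j ≥ l^{−(n−n²/N_δ)/T_δ}, and every Schwartz function u: |Q(x_0,l)|^{-1} ∫_{Q(x_0,l)} |T_j u(x)| dx ≤ C 2^{−jT_δ} l^{n²/N_δ − n} Mu(x_0). -/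

import Mathlib

open MeasureTheory Real
open scoped ENNReal NNReal InnerProductSpace BigOperators

noncomputable section

/-- `ℝⁿ` with its Euclidean structure. -/
abbrev Rn (n : ℕ) : Type := EuclideanSpace ℝ (Fin n)

/-- The Fourier transform `û(ξ) = ∫ e^{-i⟨x,ξ⟩} u(x) dx`. -/
def ft {n : ℕ} (u : Rn n → ℂ) (ξ : Rn n) : ℂ :=
  ∫ x : Rn n, Complex.exp (-(Complex.I * ((⟪x, ξ⟫_ℝ : ℝ) : ℂ))) * u x

/-- The pseudo-differential operator `T_a u(x) = ∫ e^{i⟨x,ξ⟩} a(x,ξ) û(ξ) dξ`. -/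
def pdo {n : ℕ} (a : Rn n → Rn n → ℂ) (u : Rn n → ℂ) (x : Rn n) : ℂ :=
  ∫ ξ : Rn n, Complex.exp (Complex.I * ((⟪x, ξ⟫_ℝ : ℝ) : ℂ)) * a x ξ * ft u ξ

/-- The dual operator `T_a^* u(x) = ∫∫ e^{i⟨x-y,ξ⟩} a(y,ξ) dξ u(y) dy`. -/
def pdoDual {n : ℕ} (a : Rn n → Rn n → ℂ) (u : Rn n → ℂ) (x : Rn n) : ℂ :=
  ∫ y : Rn n,
    (∫ ξ : Rn n, Complex.exp (Complex.I * ((⟪x - y, ξ⟫_ℝ : ℝ) : ℂ)) * a y ξ) * u y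

/-- The Hörmander symbol class `S^m_{ϱ,δ}`: `a` is smooth and
`|∂^β_x ∂^α_ξ a(x,ξ)| ≤ C_{α,β} (1+|ξ|²)^{(m-ϱ|α|+δ|β|)/2}`. -/
def HormClass {n : ℕ} (m ϱ δ : ℝ) (a : Rn n → Rn n → ℂ) : Prop :=
  ContDiff ℝ (⊤ : ℕ∞) (Function.uncurry a) ∧
  ∀ k l : ℕ, ∃ C : ℝ, 0 < C ∧ ∀ x ξ : Rn n,
    ‖iteratedFDeriv ℝ l (fun y : Rn n => iteratedFDeriv ℝ k (fun η : Rn n => a y η) ξ) x‖ ≤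
      C * (1 + ‖ξ‖ ^ 2) ^ ((m - ϱ * k + δ * l) / 2)

/-- The rough Hörmander class `L^∞S^m_ϱ`: `a(x,ξ)` is smooth in `ξ`, bounded measurable in `x`,
and `‖∂^α_ξ a(·,ξ)‖_{L^∞} ≤ C_α (1+|ξ|²)^{(m-ϱ|α|)/2}`. -/
def RoughClass {n : ℕ} (m ϱ : ℝ) (a : Rn n → Rn n → ℂ) : Prop :=
  (∀ x : Rn n, ContDiff ℝ (⊤ : ℕ∞) (a x)) ∧
  (∀ ξ : Rn n, Measurable fun x : Rn n => a x ξ) ∧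
  ∀ k : ℕ, ∃ C : ℝ, 0 < C ∧ ∀ ξ : Rn n, ∀ᵐ x : Rn n ∂volume,
    ‖iteratedFDeriv ℝ k (a x) ξ‖ ≤ C * (1 + ‖ξ‖ ^ 2) ^ ((m - ϱ * k) / 2)

/-- The axis-parallel cube centered at `x₀` with side length `l`. -/
def cube {n : ℕ} (x₀ : Rn n) (l : ℝ) : Set (Rn n) :=
  {y | ∀ i, |y i - x₀ i| ≤ l / 2}

/-- The Hardy–Littlewood maximal function over axis-parallel cubes. -/
def mHL {n : ℕ} {E : Type*} [NormedAddCommGroup E] (u : Rn n → E) (x : Rn n) : ℝ≥0∞ :=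
  ⨆ (x₀ : Rn n) (l : ℝ) (_ : 0 < l) (_ : x ∈ cube x₀ l),
    (∫⁻ y in cube x₀ l, (‖u y‖₊ : ℝ≥0∞)) / ENNReal.ofReal (l ^ n)

/-- The Fefferman–Stein sharp maximal function over axis-parallel cubes. -/
def mSharp {n : ℕ} (u : Rn n → ℂ) (x : Rn n) : ℝ≥0∞ :=
  ⨆ (x₀ : Rn n) (l : ℝ) (_ : 0 < l) (_ : x ∈ cube x₀ l),
    ⨅ c : ℂ, (∫⁻ y in cube x₀ l, (‖u y - c‖₊ : ℝ≥0∞)) / ENNReal.ofReal (l ^ n)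

/-- The Muckenhoupt `A₁` condition: `Mω ≤ C ω` a.e. -/
def IsA1 {n : ℕ} (ω : Rn n → ℝ) : Prop :=
  (∀ x, 0 ≤ ω x) ∧ LocallyIntegrable ω volume ∧
  ∃ C : ℝ, 0 < C ∧ ∀ᵐ x : Rn n ∂volume, mHL ω x ≤ ENNReal.ofReal (C * ω x)

/-- The Muckenhoupt `A_p` condition for `1 < p < ∞`. -/
def IsAp {n : ℕ} (p : ℝ) (ω : Rn n → ℝ) : Prop :=
  (∀ x, 0 ≤ ω x) ∧ LocallyIntegrable ω volume ∧
  ∃ C : ℝ, 0 < C ∧ ∀ (x₀ : Rn n) (l : ℝ), 0 < l →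
    ((∫⁻ y in cube x₀ l, ENNReal.ofReal (ω y)) / ENNReal.ofReal (l ^ n)) *
      (((∫⁻ y in cube x₀ l, ENNReal.ofReal (ω y ^ (1 / (1 - p)))) /
          ENNReal.ofReal (l ^ n)) ^ (p - 1))
      ≤ ENNReal.ofReal C

/-- The weighted measure `ω(s) = ∫_s ω dx`. -/
def wMeas {n : ℕ} (ω : Rn n → ℝ) (s : Set (Rn n)) : ℝ≥0∞ :=
  ∫⁻ x in s, ENNReal.ofReal (ω x)

/-- The weighted `L¹` norm `∫ |u| ω dx`. -/
def wL1 {n : ℕ} (ω : Rn n → ℝ) (u : Rn n → ℂ) : ℝ≥0∞ :=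
  ∫⁻ x : Rn n, (‖u x‖₊ : ℝ≥0∞) * ENNReal.ofReal (ω x)

/-- The weighted `L^p` norm `(∫ |u|^p ω dx)^{1/p}`. -/
def wLp {n : ℕ} (p : ℝ) (ω : Rn n → ℝ) (u : Rn n → ℂ) : ℝ≥0∞ :=
  (∫⁻ x : Rn n, (‖u x‖₊ : ℝ≥0∞) ^ p * ENNReal.ofReal (ω x)) ^ (1 / p)

/-- A Littlewood–Paley cut-off: `ψ ∈ C_c^∞`, `0 ≤ ψ ≤ 1`, supported in the annulus
`{C₀⁻¹ ≤ |ξ| ≤ 2C₀}`. -/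
def LPcut {n : ℕ} (C₀ : ℝ) (ψ : Rn n → ℝ) : Prop :=
  ContDiff ℝ (⊤ : ℕ∞) ψ ∧ HasCompactSupport ψ ∧ (∀ ξ, 0 ≤ ψ ξ) ∧ (∀ ξ, ψ ξ ≤ 1) ∧
  tsupport ψ ⊆ {ξ : Rn n | C₀⁻¹ ≤ ‖ξ‖ ∧ ‖ξ‖ ≤ 2 * C₀}

/-- `K_j(x,y) = (2π)^{-n} ∫ e^{i⟨x-y,ξ⟩} a(x,ξ) ψ(2^{-j}ξ) dξ`. -/
def Kj {n : ℕ} (a : Rn n → Rn n → ℂ) (ψ : Rn n → ℝ) (j : ℕ) (x y : Rn n) : ℂ :=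
  ((((2 * π) ^ n)⁻¹ : ℝ) : ℂ) *
    ∫ ξ : Rn n, Complex.exp (Complex.I * ((⟪x - y, ξ⟫_ℝ : ℝ) : ℂ)) * a x ξ *
      ((ψ ((((2 : ℝ) ^ j)⁻¹) • ξ) : ℝ) : ℂ)

/-- `K_j^*(x,y) = (2π)^{-n} ∫ e^{i⟨x-y,ξ⟩} a(y,ξ) ψ(2^{-j}ξ) dξ`. -/
def KjStar {n : ℕ} (a : Rn n → Rn n → ℂ) (ψ : Rn n → ℝ) (j : ℕ) (x y : Rn n) : ℂ :=
  ((((2 * π) ^ n)⁻¹ : ℝ) : ℂ) *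
    ∫ ξ : Rn n, Complex.exp (Complex.I * ((⟪x - y, ξ⟫_ℝ : ℝ) : ℂ)) * a y ξ *
      ((ψ ((((2 : ℝ) ^ j)⁻¹) • ξ) : ℝ) : ℂ)

/-- `T_j u(x) = ∫ K_j(x,y) u(y) dy`. -/
def Tj {n : ℕ} (a : Rn n → Rn n → ℂ) (ψ : Rn n → ℝ) (j : ℕ) (u : Rn n → ℂ) (x : Rn n) : ℂ :=
  ∫ y : Rn n, Kj a ψ j x y * u y

/-- `T_j^* u(x) = ∫ K_j^*(x,y) u(y) dy`. -/
def TjStar {n : ℕ} (a : Rn n → Rn n → ℂ) (ψ : Rn n → ℝ) (j : ℕ) (u : Rn n → ℂ) (x : Rn n) : ℂ :=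
  ∫ y : Rn n, KjStar a ψ j x y * u y

/-- The Fourier integral operator `T_{a,φ} u(x) = ∫ e^{iφ(x,ξ)} a(x,ξ) û(ξ) dξ`. -/
def fio {n : ℕ} (a : Rn n → Rn n → ℂ) (φ : Rn n → Rn n → ℝ) (u : Rn n → ℂ) (x : Rn n) : ℂ :=
  ∫ ξ : Rn n, Complex.exp (Complex.I * ((φ x ξ : ℝ) : ℂ)) * a x ξ * ft u ξ

/-- The dual FIO `T^*_{a,φ} u(x) = ∫∫ e^{i(φ(y,ξ)-⟨x,ξ⟩)} a(y,ξ) dξ u(y) dy`. -/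
def fioDual {n : ℕ} (a : Rn n → Rn n → ℂ) (φ : Rn n → Rn n → ℝ) (u : Rn n → ℂ) (x : Rn n) : ℂ :=
  ∫ y : Rn n,
    (∫ ξ : Rn n, Complex.exp (Complex.I * ((φ y ξ - ⟪x, ξ⟫_ℝ : ℝ) : ℂ)) * a y ξ) * u y

/-- The phase class `Φ¹`: smooth on `ℝⁿ × (ℝⁿ∖{0})`, positively homogeneous of degree 1 in `ξ`,
with `sup |ξ|^{-1+|α|} |∂^α_ξ ∂^β_x φ| ≤ C_{α,β}` for `|α|+|β| ≥ 1`. -/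
def Phi1 {n : ℕ} (φ : Rn n → Rn n → ℝ) : Prop :=
  ContDiffOn ℝ (⊤ : ℕ∞) (Function.uncurry φ) {p : Rn n × Rn n | p.2 ≠ 0} ∧
  (∀ x : Rn n, ∀ ξ : Rn n, ξ ≠ 0 → ∀ t : ℝ, 0 < t → φ x (t • ξ) = t * φ x ξ) ∧
  ∀ k l : ℕ, 1 ≤ k + l → ∃ C : ℝ, 0 < C ∧ ∀ x ξ : Rn n, ξ ≠ 0 →
    ‖ξ‖ ^ ((k : ℝ) - 1) *
        ‖iteratedFDeriv ℝ k (fun η : Rn n => iteratedFDeriv ℝ l (fun y : Rn n => φ y η) x) ξ‖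
      ≤ C

/-- The rough phase class `L^∞Φ¹`: positively homogeneous of degree 1 in `ξ`, smooth in `ξ` away
from the origin, bounded measurable in `x`, with `sup |ξ|^{-1+|α|} ‖∂^α_ξ φ(·,ξ)‖_{L^∞} ≤ C_α`
for `|α| ≥ 1`. -/
def LinfPhi1 {n : ℕ} (φ : Rn n → Rn n → ℝ) : Prop :=
  (∀ x : Rn n, ContDiffOn ℝ (⊤ : ℕ∞) (φ x) {ξ : Rn n | ξ ≠ 0}) ∧
  (∀ ξ : Rn n, Measurable fun x : Rn n => φ x ξ) ∧
  (∀ ξ : Rn n, ∃ C : ℝ, ∀ x : Rn n, |φ x ξ| ≤ C) ∧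
  (∀ x : Rn n, ∀ ξ : Rn n, ξ ≠ 0 → ∀ t : ℝ, 0 < t → φ x (t • ξ) = t * φ x ξ) ∧
  ∀ k : ℕ, 1 ≤ k → ∃ C : ℝ, 0 < C ∧ ∀ ξ : Rn n, ξ ≠ 0 → ∀ᵐ x : Rn n ∂volume,
    ‖ξ‖ ^ ((k : ℝ) - 1) * ‖iteratedFDeriv ℝ k (φ x) ξ‖ ≤ C


lemma one_add_pow_le {t : ℝ} (ht : 0 ≤ t) (M : ℕ) : (1 + t) ^ M ≤ 2 ^ M * (1 + t ^ M) := by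
  have h := add_pow_le (zero_le_one (α := ℝ)) ht M
  rw [one_pow] at h
  refine h.trans ?_
  gcongr
  · norm_num
  · omega

/-- Decay of the oscillatory integral of a smooth compactly supported function whose
derivatives of order `p ≤ M` have size `A r ^ p`. -/
lemma oscillatory_integral_decay (n M : ℕ) : ∃ D : ℝ, 0 < D ∧ ∀ (f : Rn n → ℂ),
    ContDiff ℝ (⊤ : ℕ∞) f → ∀ (c : Rn n) (R A r : ℝ), 0 ≤ R → 1 ≤ r →
    (∀ x, f x ≠ 0 → x ∈ Metric.closedBall c R) →
    (∀ p ≤ M, ∀ x, ‖iteratedFDeriv ℝ p f x‖ ≤ A * r ^ p) →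
    ∀ w : Rn n, (1 + ‖w‖ / r) ^ M *
      ‖∫ x : Rn n, Complex.exp (Complex.I * ((⟪x, w⟫_ℝ : ℝ) : ℂ)) * f x‖ ≤ D * A * R ^ n := by
  set V : ℝ := volume.real (Metric.ball (0 : Rn n) 1) with hV
  have hV0 : 0 < V := by
    rw [hV, measureReal_def]
    exact ENNReal.toReal_pos (Metric.measure_ball_pos _ _ one_pos).ne' measure_ball_lt_top.ne
  refine ⟨2 ^ M * (1 + (2 * π) ^ M * (2 ^ M * (M + 1))) * V, by positivity, ?_⟩
  intro f hf c R A r hR hr hsupp hder w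
  have hr0 : 0 < r := by linarith
  have hts : tsupport f ⊆ Metric.closedBall c R :=
    closure_minimal (fun x hx => hsupp x hx) Metric.isClosed_closedBall
  have hcs : HasCompactSupport f :=
    (isCompact_closedBall c R).of_isClosed_subset isClosed_closure hts
  have hA : 0 ≤ A := by
    have := (norm_nonneg _).trans (hder 0 (Nat.zero_le _) 0)
    simpa using this
  have hInt : ∀ p ≤ M, ∫ x, ‖iteratedFDeriv ℝ p f x‖ ≤ A * r ^ p * (R ^ n * V) := by
    intro p hp
    have h1 : ∫ x, ‖iteratedFDeriv ℝ p f x‖ =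
        ∫ x in Metric.closedBall c R, ‖iteratedFDeriv ℝ p f x‖ := by
      symm
      apply setIntegral_eq_integral_of_forall_compl_eq_zero
      intro x hx
      rw [norm_eq_zero]
      by_contra h
      exact hx (hts (support_iteratedFDeriv_subset p h))
    rw [h1]
    have h2 := norm_setIntegral_le_of_norm_le_const (μ := volume) (s := Metric.closedBall c R)
      (f := fun x => ‖iteratedFDeriv ℝ p f x‖) (C := A * r ^ p)
      measure_closedBall_lt_top (fun x _ => by simpa using hder p hp x)
    have h3 : volume.real (Metric.closedBall c R) = R ^ n * V := by
      rw [Measure.addHaar_real_closedBall _ _ hR]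
      simp [hV]
    rw [h3] at h2
    exact (le_abs_self _).trans h2
  set J := ∫ x : Rn n, Complex.exp (Complex.I * ((⟪x, w⟫_ℝ : ℝ) : ℂ)) * f x with hJ
  have hJ0 : ‖J‖ ≤ A * (R ^ n * V) := by
    refine (norm_integral_le_integral_norm _).trans ?_
    have h := hInt 0 (Nat.zero_le _)
    simp only [norm_iteratedFDeriv_zero, pow_zero, mul_one] at h
    refine le_of_eq_of_le ?_ h
    congr 1; ext x
    rw [norm_mul, mul_comm Complex.I, Complex.norm_exp_ofReal_mul_I, one_mul]
  have hJF : J = FourierTransform.fourier f (-((2 * π)⁻¹ • w)) := by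
    rw [Real.fourier_eq', hJ]
    congr 1; ext x
    rw [smul_eq_mul]
    congr 2
    rw [inner_neg_right, real_inner_smul_right]
    push_cast
    have : (π : ℂ) ≠ 0 := by exact_mod_cast Real.pi_ne_zero
    field_simp
  have hJM : (‖w‖ / r) ^ M * ‖J‖ ≤ (2 * π) ^ M * (2 ^ M * (M + 1)) * (A * (R ^ n * V)) := by
    have hi : ∀ (k m : ℕ), (k : ℕ∞) ≤ ((0 : ℕ) : ℕ∞) → (m : ℕ∞) ≤ (⊤ : ℕ∞) →
        Integrable (fun v : Rn n ↦ ‖v‖ ^ k * ‖iteratedFDeriv ℝ m f v‖) := by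
      intro k m _ _
      apply Continuous.integrable_of_hasCompactSupport
      · exact (continuous_norm.pow k).mul
          (hf.continuous_iteratedFDeriv (by exact_mod_cast le_top)).norm
      · exact ((hcs.iteratedFDeriv m).norm).mul_left
    have h := Real.pow_mul_norm_iteratedFDeriv_fourier_le (K := (0 : ℕ)) (N := ⊤) hf hi
      (k := 0) (n := M) le_rfl le_top (-((2 * π)⁻¹ • w))
    rw [norm_iteratedFDeriv_zero, ← hJF, norm_neg, norm_smul] at h
    simp only [norm_inv, zero_add, Finset.range_one, Finset.singleton_product, Finset.sum_map,
      Function.Embedding.coeFn_mk, pow_zero, one_mul, Nat.cast_zero, mul_zero] at h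
    have h2 : ∑ p ∈ Finset.range (M + 1), ∫ v, ‖iteratedFDeriv ℝ p f v‖ ≤
        (M + 1) * (A * r ^ M * (R ^ n * V)) := by
      refine (Finset.sum_le_card_nsmul _ _ (A * r ^ M * (R ^ n * V)) ?_).trans ?_
      · intro p hp
        have hp' : p ≤ M := by simpa [Nat.lt_succ_iff] using hp
        refine (hInt p hp').trans ?_
        gcongr
      · simp
    have h3 : ‖(2 * π : ℝ)‖ = 2 * π := by
      rw [Real.norm_of_nonneg]; positivity
    rw [h3] at h
    have h4 : (‖w‖ / r) ^ M * ‖J‖ =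
        (2 * π) ^ M * (((2 * π)⁻¹ * ‖w‖) ^ M * ‖J‖) / r ^ M := by
      rw [div_pow, mul_pow (2 * π)⁻¹, inv_pow]
      field_simp
    rw [h4, div_le_iff₀ (by positivity)]
    calc (2 * π) ^ M * (((2 * π)⁻¹ * ‖w‖) ^ M * ‖J‖)
        ≤ (2 * π) ^ M * (2 ^ M * ((M + 1) * (A * r ^ M * (R ^ n * V)))) := by
          exact mul_le_mul_of_nonneg_left
            (h.trans (mul_le_mul_of_nonneg_left h2 (by positivity))) (by positivity)
      _ = _ := by ring
  calc (1 + ‖w‖ / r) ^ M * ‖J‖ ≤ 2 ^ M * (1 + (‖w‖ / r) ^ M) * ‖J‖ := by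
        gcongr
        exact one_add_pow_le (by positivity) M
    _ = 2 ^ M * (‖J‖ + (‖w‖ / r) ^ M * ‖J‖) := by ring
    _ ≤ 2 ^ M * (A * (R ^ n * V) + (2 * π) ^ M * (2 ^ M * (M + 1)) * (A * (R ^ n * V))) := by
        gcongr
    _ = _ := by ring

/-- Leibniz bound for functions whose `p`-th derivatives scale like `r ^ p`. -/
lemma norm_iteratedFDeriv_mul_le_scaled {n : ℕ} {f g : Rn n → ℂ}
    (hf : ContDiff ℝ (⊤ : ℕ∞) f) (hg : ContDiff ℝ (⊤ : ℕ∞) g) {M : ℕ} {A B r : ℝ} (hr : 0 ≤ r)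
    (x : Rn n) (hfA : ∀ p ≤ M, ‖iteratedFDeriv ℝ p f x‖ ≤ A * r ^ p)
    (hgB : ∀ p ≤ M, ‖iteratedFDeriv ℝ p g x‖ ≤ B * r ^ p) :
    ∀ p ≤ M, ‖iteratedFDeriv ℝ p (fun y => f y * g y) x‖ ≤ 2 ^ M * A * B * r ^ p := by
  intro p hp
  have hA : 0 ≤ A := by simpa using (norm_nonneg _).trans (hfA 0 (Nat.zero_le _))
  have hB : 0 ≤ B := by simpa using (norm_nonneg _).trans (hgB 0 (Nat.zero_le _))
  refine (norm_iteratedFDeriv_mul_le (N := (⊤ : ℕ∞)) hf hg x (by exact_mod_cast le_top)).trans ?_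
  calc ∑ i ∈ Finset.range (p + 1), (p.choose i : ℝ) * ‖iteratedFDeriv ℝ i f x‖ *
        ‖iteratedFDeriv ℝ (p - i) g x‖
      ≤ ∑ i ∈ Finset.range (p + 1), (p.choose i : ℝ) * (A * B * r ^ p) := by
        refine Finset.sum_le_sum fun i hi => ?_
        have hi' : i ≤ p := by simpa [Nat.lt_succ_iff] using hi
        calc (p.choose i : ℝ) * ‖iteratedFDeriv ℝ i f x‖ * ‖iteratedFDeriv ℝ (p - i) g x‖
            ≤ (p.choose i : ℝ) * (A * r ^ i) * (B * r ^ (p - i)) := by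
              gcongr
              · exact hfA i (hi'.trans hp)
              · exact hgB _ ((Nat.sub_le _ _).trans hp)
          _ = (p.choose i : ℝ) * (A * B * (r ^ i * r ^ (p - i))) := by ring
          _ = _ := by rw [← pow_add, Nat.add_sub_cancel' hi']
    _ = 2 ^ p * (A * B * r ^ p) := by
        rw [← Finset.sum_mul]
        congr 1
        exact_mod_cast Nat.sum_range_choose p
    _ ≤ 2 ^ M * (A * B * r ^ p) := by
        gcongr
        norm_num
    _ = _ := by ring

lemma exists_uniform_bound {ι : Type*} {F G : ℕ → ι → ℝ} (hG : ∀ p i, 0 ≤ G p i)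
    (h : ∀ p, ∃ C : ℝ, 0 < C ∧ ∀ i, F p i ≤ C * G p i) (M : ℕ) :
    ∃ C : ℝ, 0 < C ∧ ∀ p ≤ M, ∀ i, F p i ≤ C * G p i := by
  choose C hC0 hC using h
  refine ⟨∑ p ∈ Finset.range (M + 1), C p, Finset.sum_pos (fun p _ => hC0 p) (by simp), ?_⟩
  intro p hp i
  refine (hC p i).trans (mul_le_mul_of_nonneg_right ?_ (hG p i))
  exact Finset.single_le_sum (fun q _ => (hC0 q).le) (by simpa [Nat.lt_succ_iff] using hp)


/-- A frequency-localised symbol `a(x,ξ) ψ(λ⁻¹ξ)`. -/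
def locSymbol {n : ℕ} (a : Rn n → Rn n → ℂ) (ψ : Rn n → ℝ) (lam : ℝ) (x ξ : Rn n) : ℂ :=
  a x ξ * ((ψ (lam⁻¹ • ξ) : ℝ) : ℂ)

lemma rpow_weight_le {p q lam t s : ℝ} (hp : 0 < p) (hlam : 0 < lam)
    (h1 : p * lam ^ 2 ≤ t) (h2 : t ≤ q * lam ^ 2) :
    t ^ (s / 2) ≤ (p ^ (s / 2) + q ^ (s / 2)) * lam ^ s := by
  have hpl : 0 < p * lam ^ 2 := by positivity
  have hq : 0 < q := by
    by_contra h
    nlinarith [sq_nonneg lam]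
  have hl : (lam ^ 2) ^ (s / 2) = lam ^ s := by
    rw [← Real.rpow_natCast, ← Real.rpow_mul hlam.le]
    congr 1
    push_cast
    ring
  have hp' := Real.rpow_nonneg hp.le (s / 2)
  have hq' := Real.rpow_nonneg hq.le (s / 2)
  have hl' := Real.rpow_nonneg hlam.le s
  rcases le_total 0 (s / 2) with hs | hs
  · refine (Real.rpow_le_rpow (hpl.le.trans h1) h2 hs).trans ?_
    rw [Real.mul_rpow hq.le (by positivity), hl]
    nlinarith
  · refine (Real.rpow_le_rpow_of_nonpos hpl h1 hs).trans ?_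
    rw [Real.mul_rpow hp.le (by positivity), hl]
    nlinarith

lemma norm_bounds_of_cutoff_ne_zero {n : ℕ} {C₀ : ℝ} {ψ : Rn n → ℝ} (hψ : LPcut C₀ ψ)
    {lam : ℝ} (hlam : 0 < lam) {ξ : Rn n} (h : lam⁻¹ • ξ ∈ tsupport ψ) :
    C₀⁻¹ * lam ≤ ‖ξ‖ ∧ ‖ξ‖ ≤ 2 * C₀ * lam := by
  have h1 := hψ.2.2.2.2 h
  simp only [Set.mem_ofPred_eq, norm_smul, norm_inv, Real.norm_of_nonneg hlam.le] at h1
  rw [inv_mul_eq_div, le_div_iff₀ hlam, div_le_iff₀ hlam] at h1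
  exact h1

lemma weight_le_on_annulus {C₀ : ℝ} (hC₀ : 1 < C₀) (s : ℝ) : ∃ C : ℝ, 0 < C ∧
    ∀ lam t : ℝ, 1 ≤ lam → C₀⁻¹ * lam ≤ t → t ≤ 2 * C₀ * lam →
      (1 + t ^ 2) ^ (s / 2) ≤ C * lam ^ s := by
  have hC : 0 < C₀⁻¹ := by positivity
  refine ⟨(C₀⁻¹ ^ 2) ^ (s / 2) + (1 + (2 * C₀) ^ 2) ^ (s / 2), by positivity, ?_⟩
  intro lam t hl h1 h2
  have ht : 0 ≤ t := le_trans (by positivity) h1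
  refine rpow_weight_le (by positivity) (by linarith) ?_ ?_
  · rw [← mul_pow]
    have := pow_le_pow_left₀ (by positivity) h1 2
    linarith
  · have := pow_le_pow_left₀ ht h2 2
    rw [mul_pow] at this
    nlinarith

section Symbol

variable {n : ℕ} {δ : ℝ} {a : Rn n → Rn n → ℂ} {C₀ : ℝ} {ψ : Rn n → ℝ}

lemma HormClass.contDiff_left {m ϱ : ℝ} (ha : HormClass m ϱ δ a) (ξ : Rn n) :
    ContDiff ℝ (⊤ : ℕ∞) (fun x => a x ξ) :=
  ha.1.comp (contDiff_id.prodMk contDiff_const)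

lemma HormClass.contDiff_right {m ϱ : ℝ} (ha : HormClass m ϱ δ a) (x : Rn n) :
    ContDiff ℝ (⊤ : ℕ∞) (fun ξ => a x ξ) :=
  ha.1.comp (contDiff_const.prodMk contDiff_id)

lemma HormClass.bound_left {m ϱ : ℝ} (ha : HormClass m ϱ δ a) (p : ℕ) :
    ∃ C : ℝ, 0 < C ∧ ∀ x ξ : Rn n, ‖iteratedFDeriv ℝ p (fun y => a y ξ) x‖ ≤
      C * (1 + ‖ξ‖ ^ 2) ^ ((m + δ * p) / 2) := by
  obtain ⟨C, hC0, hC⟩ := ha.2 0 p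
  refine ⟨C, hC0, fun x ξ => ?_⟩
  have h := hC x ξ
  simp only [iteratedFDeriv_zero_eq_comp, Function.comp_apply] at h
  have h2 := LinearIsometryEquiv.norm_iteratedFDeriv_comp_left
    (continuousMultilinearCurryFin0 ℝ (Rn n) ℂ).symm (fun y => a y ξ) x p
  rw [Function.comp_def] at h2
  rw [h2] at h
  simpa using h

lemma HormClass.bound_right {m ϱ : ℝ} (ha : HormClass m ϱ δ a) (p : ℕ) :
    ∃ C : ℝ, 0 < C ∧ ∀ x ξ : Rn n, ‖iteratedFDeriv ℝ p (fun η => a x η) ξ‖ ≤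
      C * (1 + ‖ξ‖ ^ 2) ^ ((m - ϱ * p) / 2) := by
  obtain ⟨C, hC0, hC⟩ := ha.2 p 0
  refine ⟨C, hC0, fun x ξ => ?_⟩
  have h := hC x ξ
  rw [norm_iteratedFDeriv_zero] at h
  simpa using h

lemma continuous_locSymbol {m ϱ : ℝ} (ha : HormClass m ϱ δ a) (hψ : LPcut C₀ ψ) (lam : ℝ) :
    Continuous (fun z : Rn n × Rn n => locSymbol a ψ lam z.1 z.2) := by
  unfold locSymbol
  refine (ha.1.continuous.comp continuous_id).mul (Complex.continuous_ofReal.comp ?_)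
  exact hψ.1.continuous.comp (by fun_prop : Continuous fun z : Rn n × Rn n => lam⁻¹ • z.2)

lemma locSymbol_eq_zero (hψ : LPcut C₀ ψ) {lam : ℝ} (hlam : 0 < lam) (x : Rn n) {ξ : Rn n}
    (h : locSymbol a ψ lam x ξ ≠ 0) : ξ ∈ Metric.closedBall (0 : Rn n) (2 * C₀ * lam) := by
  have h1 : ψ (lam⁻¹ • ξ) ≠ 0 := by
    intro h0
    simp [locSymbol, h0] at h
  simpa using (norm_bounds_of_cutoff_ne_zero hψ hlam (subset_tsupport _ h1)).2

/-- `x`-derivatives of the localised symbol. -/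
lemma locSymbol_bound_left (hC₀ : 1 < C₀) (ha : HormClass (-(n : ℝ)) 0 δ a) (hψ : LPcut C₀ ψ)
    (M : ℕ) : ∃ C : ℝ, 0 < C ∧ ∀ p ≤ M, ∀ lam : ℝ, 1 ≤ lam → ∀ x ξ : Rn n,
      ‖iteratedFDeriv ℝ p (fun y => locSymbol a ψ lam y ξ) x‖ ≤
        C * lam ^ (-(n : ℝ)) * (lam ^ δ) ^ p := by
  have key : ∀ p : ℕ, ∃ C : ℝ, 0 < C ∧ ∀ i : {t : ℝ // 1 ≤ t} × Rn n × Rn n,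
      ‖iteratedFDeriv ℝ p (fun y => locSymbol a ψ i.1 y i.2.2) i.2.1‖ ≤
        C * ((i.1 : ℝ) ^ (-(n : ℝ)) * ((i.1 : ℝ) ^ δ) ^ p) := by
    intro p
    obtain ⟨C, hC, h⟩ := ha.bound_left p
    obtain ⟨D, hD, hw⟩ := weight_le_on_annulus hC₀ (-(n : ℝ) + δ * p)
    refine ⟨C * D, by positivity, ?_⟩
    rintro ⟨⟨lam, hl⟩, x, ξ⟩
    have hl0 : 0 < lam := by linarith
    simp only
    by_cases hξ : ψ (lam⁻¹ • ξ) = 0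
    · have h0 : (fun y => locSymbol a ψ lam y ξ) = fun _ => 0 := by
        ext y; simp [locSymbol, hξ]
      rw [h0, iteratedFDeriv_fun_zero]
      simp only [Pi.zero_apply, norm_zero]
      positivity
    · obtain ⟨h1, h2⟩ := norm_bounds_of_cutoff_ne_zero hψ hl0 (subset_tsupport _ hξ)
      have h3 : (fun y => locSymbol a ψ lam y ξ) =
          (((ψ (lam⁻¹ • ξ) : ℝ) : ℂ)) • fun y => a y ξ := by
        ext y; simp [locSymbol, mul_comm]
      rw [h3, iteratedFDeriv_const_smul_apply
        ((ha.contDiff_left ξ).contDiffAt.of_le (by exact_mod_cast le_top)), norm_smul]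
      have h4 : ‖((ψ (lam⁻¹ • ξ) : ℝ) : ℂ)‖ ≤ 1 := by
        rw [Complex.norm_real, Real.norm_of_nonneg (hψ.2.2.1 _)]
        exact hψ.2.2.2.1 _
      have h5 : lam ^ (-(n : ℝ) + δ * p) = lam ^ (-(n : ℝ)) * (lam ^ δ) ^ p := by
        rw [Real.rpow_add hl0, Real.rpow_mul hl0.le, Real.rpow_natCast]
      rw [← h5]
      calc _ ≤ 1 * (C * (D * lam ^ (-(n : ℝ) + δ * p))) := by
            refine mul_le_mul h4 ((h x ξ).trans ?_) (norm_nonneg _) zero_le_one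
            exact mul_le_mul_of_nonneg_left (hw lam _ hl h1 h2) hC.le
        _ = _ := by ring
  obtain ⟨C, hC, h⟩ := exists_uniform_bound (fun p i => by
    have : (0 : ℝ) < i.1 := by linarith [i.1.2]
    positivity) key M
  refine ⟨C, hC, fun p hp lam hl x ξ => ?_⟩
  rw [mul_assoc]
  exact h p hp ⟨⟨lam, hl⟩, x, ξ⟩

lemma cutoff_deriv_bound (hψ : LPcut C₀ ψ) (p : ℕ) : ∃ C : ℝ, 0 < C ∧ ∀ lam : ℝ, 1 ≤ lam →
    ∀ ξ : Rn n, ‖iteratedFDeriv ℝ p (fun η => ((ψ (lam⁻¹ • η) : ℝ) : ℂ)) ξ‖ ≤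
      C * Set.indicator (tsupport ψ) (fun _ => (1 : ℝ)) (lam⁻¹ • ξ) := by
  set Ψ : Rn n → ℂ := fun η => ((ψ η : ℝ) : ℂ) with hΨ
  have hs : ContDiff ℝ (⊤ : ℕ∞) Ψ := Complex.ofRealCLM.contDiff.comp hψ.1
  have hts : tsupport Ψ ⊆ tsupport ψ := by
    apply closure_mono
    intro x hx h
    exact hx (by simp [hΨ, h])
  have hc : HasCompactSupport Ψ := hψ.2.1.of_isClosed_subset isClosed_closure hts
  obtain ⟨C, hC⟩ := (hs.continuous_iteratedFDeriv (m := p)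
    (by exact_mod_cast le_top)).bounded_above_of_compact_support (hc.iteratedFDeriv p)
  refine ⟨max C 1, by positivity, fun lam hl ξ => ?_⟩
  have h1 := iteratedFDeriv_comp_const_smul (i := p) lam⁻¹
    (f := Ψ) (hs.of_le (by exact_mod_cast le_top))
  change ‖iteratedFDeriv ℝ p (fun η => Ψ (lam⁻¹ • η)) ξ‖ ≤ _
  rw [h1]
  simp only
  rw [norm_smul]
  have hl1 : ‖lam⁻¹ ^ p‖ ≤ 1 := by
    rw [Real.norm_of_nonneg (by positivity)]
    exact pow_le_one₀ (by positivity) (inv_le_one_of_one_le₀ hl)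
  by_cases hm : lam⁻¹ • ξ ∈ tsupport ψ
  · rw [Set.indicator_of_mem hm]
    rw [mul_one]
    calc _ ≤ 1 * max C 1 :=
          mul_le_mul hl1 ((hC _).trans (le_max_left _ _)) (norm_nonneg _) zero_le_one
      _ = _ := one_mul _
  · have : iteratedFDeriv ℝ p Ψ (lam⁻¹ • ξ) = 0 := by
      by_contra h
      exact hm (hts (support_iteratedFDeriv_subset p h))
    rw [this, Set.indicator_of_notMem hm]
    simp

/-- `ξ`-derivatives of the localised symbol. -/
lemma locSymbol_bound_right (hC₀ : 1 < C₀) (ha : HormClass (-(n : ℝ)) 0 δ a) (hψ : LPcut C₀ ψ)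
    (M : ℕ) : ∃ C : ℝ, 0 < C ∧ ∀ p ≤ M, ∀ lam : ℝ, 1 ≤ lam → ∀ x ξ : Rn n,
      ‖iteratedFDeriv ℝ p (fun η => locSymbol a ψ lam x η) ξ‖ ≤ C * lam ^ (-(n : ℝ)) := by
  obtain ⟨A, hA, ha'⟩ := exists_uniform_bound (ι := Rn n × Rn n)
    (F := fun p i => ‖iteratedFDeriv ℝ p (fun η => a i.1 η) i.2‖)
    (G := fun p i => (1 + ‖i.2‖ ^ 2) ^ ((-(n : ℝ) - 0 * p) / 2)) (fun p i => by positivity)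
    (fun p => by
      obtain ⟨C, hC, h⟩ := ha.bound_right p
      exact ⟨C, hC, fun i => h i.1 i.2⟩) M
  obtain ⟨B, hB, hb⟩ := exists_uniform_bound (ι := {t : ℝ // 1 ≤ t} × Rn n)
    (F := fun p i => ‖iteratedFDeriv ℝ p (fun η => ((ψ ((i.1 : ℝ)⁻¹ • η) : ℝ) : ℂ)) i.2‖)
    (G := fun p i => Set.indicator (tsupport ψ) (fun _ => (1 : ℝ)) ((i.1 : ℝ)⁻¹ • i.2))
    (fun p i => Set.indicator_nonneg (fun _ _ => zero_le_one) _)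
    (fun p => by
      obtain ⟨C, hC, h⟩ := cutoff_deriv_bound hψ p
      exact ⟨C, hC, fun i => h i.1 i.1.2 i.2⟩) M
  obtain ⟨D, hD, hw⟩ := weight_le_on_annulus hC₀ (-(n : ℝ))
  refine ⟨2 ^ M * (A * D) * B, by positivity, fun p hp lam hl x ξ => ?_⟩
  have hl0 : 0 < lam := by linarith
  have hψs : ContDiff ℝ (⊤ : ℕ∞) (fun η : Rn n => ((ψ (lam⁻¹ • η) : ℝ) : ℂ)) :=
    Complex.ofRealCLM.contDiff.comp (hψ.1.comp (contDiff_const_smul _))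
  by_cases hm : lam⁻¹ • ξ ∈ tsupport ψ
  · obtain ⟨h1, h2⟩ := norm_bounds_of_cutoff_ne_zero hψ hl0 hm
    have h := norm_iteratedFDeriv_mul_le_scaled (ha.contDiff_right x) hψs (M := M)
      (A := A * D * lam ^ (-(n : ℝ))) (B := B) zero_le_one ξ
      (fun q hq => by
        refine (ha' q hq (x, ξ)).trans ?_
        simp only [zero_mul, sub_zero, one_pow, mul_one]
        rw [mul_assoc]
        exact mul_le_mul_of_nonneg_left (hw lam _ hl h1 h2) hA.le)
      (fun q hq => by
        refine (hb q hq (⟨lam, hl⟩, ξ)).trans ?_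
        simp [Set.indicator_of_mem hm]) p hp
    refine h.trans (le_of_eq ?_)
    rw [one_pow]; ring
  · have h0 : iteratedFDeriv ℝ p (fun η => locSymbol a ψ lam x η) ξ = 0 := by
      by_contra h
      have h2 := support_iteratedFDeriv_subset p h
      apply hm
      have h3 : tsupport (fun η => locSymbol a ψ lam x η) ⊆ (fun η => lam⁻¹ • η) ⁻¹' tsupport ψ := by
        refine closure_minimal ?_ ((isClosed_tsupport ψ).preimage (continuous_const_smul _))
        intro η hη
        apply subset_tsupport
        intro h4
        exact hη (by simp [locSymbol, h4])
      exact h3 h2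
    rw [h0, norm_zero]
    positivity

end Symbol

section Kernel

variable {n : ℕ} {δ : ℝ} {a : Rn n → Rn n → ℂ} {C₀ : ℝ} {ψ : Rn n → ℝ}

lemma Kj_eq (a : Rn n → Rn n → ℂ) (ψ : Rn n → ℝ) (j : ℕ) (x y : Rn n) :
    Kj a ψ j x y = ((((2 * π) ^ n)⁻¹ : ℝ) : ℂ) *
      ∫ ξ : Rn n, Complex.exp (Complex.I * ((⟪x - y, ξ⟫_ℝ : ℝ) : ℂ)) *
        locSymbol a ψ (2 ^ j) x ξ := by
  simp only [Kj, locSymbol, mul_assoc]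

lemma norm_kernel_const_le_one (n : ℕ) : ‖((((2 * π) ^ n)⁻¹ : ℝ) : ℂ)‖ ≤ 1 := by
  rw [Complex.norm_real, Real.norm_of_nonneg (by positivity)]
  apply inv_le_one_of_one_le₀
  apply one_le_pow₀
  linarith [Real.pi_gt_three]

lemma rpow_neg_natCast_mul_pow {lam : ℝ} (h : 0 < lam) (n : ℕ) :
    lam ^ (-(n : ℝ)) * lam ^ n = 1 := by
  rw [Real.rpow_neg h.le, Real.rpow_natCast]
  exact inv_mul_cancel₀ (by positivity)

/-- Rapid off-diagonal decay of the dyadic kernels, uniformly in `j`. -/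
lemma Kj_decay (hC₀ : 1 < C₀) (ha : HormClass (-(n : ℝ)) 0 δ a) (hψ : LPcut C₀ ψ) (M : ℕ) :
    ∃ C : ℝ, 0 < C ∧ ∀ (j : ℕ) (x y : Rn n), (1 + ‖x - y‖) ^ M * ‖Kj a ψ j x y‖ ≤ C := by
  obtain ⟨D, hD, hosc⟩ := oscillatory_integral_decay n M
  obtain ⟨C, hC, hb⟩ := locSymbol_bound_right hC₀ ha hψ M
  refine ⟨D * C * (2 * C₀) ^ n, by positivity, fun j x y => ?_⟩
  have hl : (1 : ℝ) ≤ 2 ^ j := one_le_pow₀ (by norm_num)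
  have hl0 : (0 : ℝ) < 2 ^ j := by positivity
  have hs : ContDiff ℝ (⊤ : ℕ∞) (fun ξ => locSymbol a ψ (2 ^ j) x ξ) :=
    (ha.contDiff_right x).mul
      (Complex.ofRealCLM.contDiff.comp (hψ.1.comp (contDiff_const_smul _)))
  have h := hosc (fun ξ => locSymbol a ψ (2 ^ j) x ξ) hs 0 (2 * C₀ * 2 ^ j)
    (C * (2 ^ j : ℝ) ^ (-(n : ℝ))) 1 (by positivity) le_rfl
    (fun ξ hξ => locSymbol_eq_zero hψ hl0 x hξ)
    (fun p hp ξ => by simpa using hb p hp _ hl x ξ) (x - y)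
  rw [div_one] at h
  rw [Kj_eq, norm_mul]
  simp only [real_inner_comm _ (x - y)] at h ⊢
  calc _ ≤ (1 + ‖x - y‖) ^ M * (1 * ‖∫ ξ : Rn n,
        Complex.exp (Complex.I * ((⟪ξ, x - y⟫_ℝ : ℝ) : ℂ)) * locSymbol a ψ (2 ^ j) x ξ‖) := by
        gcongr
        exact norm_kernel_const_le_one n
    _ ≤ D * (C * (2 ^ j : ℝ) ^ (-(n : ℝ))) * (2 * C₀ * 2 ^ j) ^ n := by
        rw [one_mul]; exact h
    _ = D * C * (2 * C₀) ^ n * ((2 ^ j : ℝ) ^ (-(n : ℝ)) * (2 ^ j : ℝ) ^ n) := by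
        rw [mul_pow _ ((2 : ℝ) ^ j)]; ring
    _ = _ := by rw [rpow_neg_natCast_mul_pow hl0, mul_one]

lemma continuous_Kj (ha : HormClass (-(n : ℝ)) 0 δ a) (hψ : LPcut C₀ ψ) (j : ℕ) :
    Continuous (fun z : Rn n × Rn n => Kj a ψ j z.1 z.2) := by
  simp only [Kj_eq]
  refine continuous_const.mul ?_
  have hl0 : (0 : ℝ) < 2 ^ j := by positivity
  have h1 : ∀ z : Rn n × Rn n, ∫ ξ : Rn n,
      Complex.exp (Complex.I * ((⟪z.1 - z.2, ξ⟫_ℝ : ℝ) : ℂ)) * locSymbol a ψ (2 ^ j) z.1 ξ =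
      ∫ ξ in Metric.closedBall (0 : Rn n) (2 * C₀ * 2 ^ j),
      Complex.exp (Complex.I * ((⟪z.1 - z.2, ξ⟫_ℝ : ℝ) : ℂ)) * locSymbol a ψ (2 ^ j) z.1 ξ := by
    intro z
    symm
    apply setIntegral_eq_integral_of_forall_compl_eq_zero
    intro ξ hξ
    have : locSymbol a ψ (2 ^ j) z.1 ξ = 0 := by
      by_contra h
      exact hξ (locSymbol_eq_zero hψ hl0 z.1 h)
    rw [this, mul_zero]
  simp only [h1]
  refine continuous_parametric_integral_of_continuous ?_ (isCompact_closedBall _ _)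
  have hc := continuous_locSymbol ha hψ (2 ^ j)
  have hc' : Continuous (fun q : (Rn n × Rn n) × Rn n => locSymbol a ψ (2 ^ j) q.1.1 q.2) :=
    hc.comp ((continuous_fst.comp continuous_fst).prodMk continuous_snd)
  refine Continuous.mul ?_ hc'
  fun_prop

/-- The total mass of the scaled profile `(1 + |v| / r)^{-(n+1)}`. -/
lemma lintegral_profile (n : ℕ) : ∃ I : ℝ, 0 ≤ I ∧ ∀ r : ℝ, 0 < r →
    ∫⁻ v : Rn n, ENNReal.ofReal (((1 + ‖v‖ / r) ^ (n + 1))⁻¹) = ENNReal.ofReal (r ^ n * I) := by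
  have hInt : Integrable (fun v : Rn n => ((1 + ‖v‖) ^ (n + 1))⁻¹) := by
    have h := integrable_one_add_norm (E := Rn n) (μ := volume) (r := (n : ℝ) + 1) (by simp)
    refine h.congr (Filter.Eventually.of_forall fun v => ?_)
    simp only
    rw [Real.rpow_neg (by positivity), ← Real.rpow_natCast]
    push_cast
    rfl
  refine ⟨∫ v : Rn n, ((1 + ‖v‖) ^ (n + 1))⁻¹, integral_nonneg fun v => by positivity, ?_⟩
  intro r hr
  have heq : (fun v : Rn n => ((1 + ‖v‖ / r) ^ (n + 1))⁻¹) =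
      fun v : Rn n => (fun v : Rn n => ((1 + ‖v‖) ^ (n + 1))⁻¹) (r⁻¹ • v) := by
    ext v
    simp only [norm_smul, norm_inv, Real.norm_of_nonneg hr.le]
    rw [inv_mul_eq_div]
  have hi2 : Integrable (fun v : Rn n => ((1 + ‖v‖ / r) ^ (n + 1))⁻¹) := by
    rw [heq]
    exact hInt.comp_smul (inv_ne_zero hr.ne')
  rw [← ofReal_integral_eq_lintegral_ofReal hi2
    (Filter.Eventually.of_forall fun v => by positivity), heq,
    Measure.integral_comp_inv_smul_of_nonneg volume
      (fun v : Rn n => ((1 + ‖v‖) ^ (n + 1))⁻¹) hr.le]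
  simp

/-- Fourier decay in `x` of the interaction of two frequencies. -/
lemma frequency_interaction_decay (hC₀ : 1 < C₀) (hδ0 : 0 ≤ δ)
    (ha : HormClass (-(n : ℝ)) 0 δ a) (hψ : LPcut C₀ ψ)
    {χ : Rn n → ℝ} (hχ : ContDiff ℝ (⊤ : ℕ∞) χ) {R : ℝ} (hR : 0 ≤ R)
    (hχR : ∀ x, χ x ≠ 0 → ‖x‖ ≤ R) :
    ∃ C : ℝ, 0 < C ∧ ∀ lam : ℝ, 1 ≤ lam → ∀ x₀ ξ η : Rn n,
      ‖∫ x : Rn n, Complex.exp (Complex.I * ((⟪x, ξ - η⟫_ℝ : ℝ) : ℂ)) *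
        (((χ (x - x₀) : ℝ) : ℂ) * (locSymbol a ψ lam x ξ *
          (starRingEnd ℂ) (locSymbol a ψ lam x η)))‖ ≤
      C * lam ^ (-(n : ℝ)) * lam ^ (-(n : ℝ)) * ((1 + ‖ξ - η‖ / lam ^ δ) ^ (n + 1))⁻¹ := by
  obtain ⟨D, hD, hosc⟩ := oscillatory_integral_decay n (n + 1)
  obtain ⟨B, hB, hb⟩ := locSymbol_bound_left hC₀ ha hψ (n + 1)
  set X : Rn n → ℂ := fun x => ((χ x : ℝ) : ℂ) with hX
  have hXs : ContDiff ℝ (⊤ : ℕ∞) X := Complex.ofRealCLM.contDiff.comp hχ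
  have hXc : HasCompactSupport X := by
    refine HasCompactSupport.intro (isCompact_closedBall (0 : Rn n) R) fun x hx => ?_
    have : χ x = 0 := by
      by_contra h
      exact hx (by simpa using hχR x h)
    simp [hX, this]
  obtain ⟨E, hE, he⟩ := exists_uniform_bound (ι := Rn n)
    (F := fun p x => ‖iteratedFDeriv ℝ p X x‖) (G := fun _ _ => 1) (fun _ _ => zero_le_one)
    (fun p => by
      obtain ⟨C, hC⟩ := (hXs.continuous_iteratedFDeriv (m := p)
        (by exact_mod_cast le_top)).bounded_above_of_compact_support (hXc.iteratedFDeriv p)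
      exact ⟨max C 1, by positivity, fun x => by
        rw [mul_one]; exact (hC x).trans (le_max_left _ _)⟩) (n + 1)
  refine ⟨D * (2 ^ (n + 1) * E * (2 ^ (n + 1) * B * B)) * (R + 1) ^ n, by positivity, ?_⟩
  intro lam hl x₀ ξ η
  have hl0 : 0 < lam := by linarith
  have hr : 1 ≤ lam ^ δ := Real.one_le_rpow hl hδ0
  set N : ℝ := lam ^ (-(n : ℝ)) with hN
  have hbs : ∀ ζ, ContDiff ℝ (⊤ : ℕ∞) (fun x => locSymbol a ψ lam x ζ) := fun ζ =>
    (ha.contDiff_left ζ).mul contDiff_const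
  have hbc : ContDiff ℝ (⊤ : ℕ∞) (fun x => (starRingEnd ℂ) (locSymbol a ψ lam x η)) :=
    Complex.conjCLE.contDiff.comp (hbs η)
  have hXt : ContDiff ℝ (⊤ : ℕ∞) (fun x => X (x - x₀)) :=
    hXs.comp (contDiff_id.sub contDiff_const)
  have h := hosc (fun x => X (x - x₀) * (locSymbol a ψ lam x ξ *
      (starRingEnd ℂ) (locSymbol a ψ lam x η))) (hXt.mul ((hbs ξ).mul hbc)) x₀ (R + 1)
    (2 ^ (n + 1) * E * (2 ^ (n + 1) * (B * N) * (B * N))) (lam ^ δ) (by positivity) hr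
    (fun x hx => by
      have h1 : χ (x - x₀) ≠ 0 := by
        intro h0
        simp [hX, h0] at hx
      rw [Metric.mem_closedBall, dist_eq_norm]
      linarith [hχR _ h1])
    (fun p hp x => by
      refine norm_iteratedFDeriv_mul_le_scaled hXt ((hbs ξ).mul hbc) (by positivity) x ?_ ?_ p hp
      · intro q hq
        rw [iteratedFDeriv_comp_sub]
        refine (he q hq _).trans ?_
        exact mul_le_mul_of_nonneg_left (one_le_pow₀ hr) hE.le
      · refine norm_iteratedFDeriv_mul_le_scaled (hbs ξ) hbc (by positivity) x ?_ ?_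
        · intro q hq
          exact hb q hq lam hl x ξ
        · intro q hq
          refine le_of_eq_of_le ?_ (hb q hq lam hl x η)
          exact LinearIsometryEquiv.norm_iteratedFDeriv_comp_left Complex.conjLIE
            (fun x => locSymbol a ψ lam x η) x q) (ξ - η)
  rw [← div_eq_mul_inv, le_div_iff₀ (by positivity), mul_comm]
  refine h.trans (le_of_eq ?_)
  ring

lemma integral_mul_norm_integral_sq {κ : Rn n → ℂ} (hκ : Continuous κ) {P : Rn n → Rn n → ℂ}
    (hP : Continuous fun q : Rn n × Rn n => P q.1 q.2) {s t : Set (Rn n)} (hs : IsCompact s)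
    (ht : IsCompact t) (hκs : ∀ x, κ x ≠ 0 → x ∈ s) (hPt : ∀ x ξ, P x ξ ≠ 0 → ξ ∈ t) :
    ∫ x : Rn n, κ x * ((‖∫ ξ : Rn n, P x ξ‖ ^ 2 : ℝ) : ℂ) =
      ∫ z : Rn n × Rn n, ∫ x : Rn n, κ x * (P x z.1 * (starRingEnd ℂ) (P x z.2)) := by
  have h1 : ∀ x, κ x * ((‖∫ ξ : Rn n, P x ξ‖ ^ 2 : ℝ) : ℂ) =
      ∫ z : Rn n × Rn n, κ x * (P x z.1 * (starRingEnd ℂ) (P x z.2)) := by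
    intro x
    rw [integral_const_mul]
    congr 1
    have h2 := integral_prod_mul (μ := (volume : Measure (Rn n))) (ν := (volume : Measure (Rn n)))
      (fun ξ => P x ξ) (fun η => (starRingEnd ℂ) (P x η))
    rw [integral_conj, Complex.mul_conj, Complex.normSq_eq_norm_sq] at h2
    exact h2.symm
  simp only [h1]
  have c1 : Continuous fun q : Rn n × (Rn n × Rn n) => κ q.1 := hκ.comp continuous_fst
  have c2 : Continuous fun q : Rn n × (Rn n × Rn n) => P q.1 q.2.1 :=
    hP.comp (g := fun q : Rn n × Rn n => P q.1 q.2)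
      (f := fun q : Rn n × (Rn n × Rn n) => (q.1, q.2.1)) (by fun_prop)
  have c3 : Continuous fun q : Rn n × (Rn n × Rn n) => P q.1 q.2.2 :=
    hP.comp (g := fun q : Rn n × Rn n => P q.1 q.2)
      (f := fun q : Rn n × (Rn n × Rn n) => (q.1, q.2.2)) (by fun_prop)
  refine integral_integral_swap_of_hasCompactSupport (μ := (volume : Measure (Rn n)))
    (ν := (volume : Measure (Rn n × Rn n)))
    (f := fun (x : Rn n) (z : Rn n × Rn n) => κ x * (P x z.1 * (starRingEnd ℂ) (P x z.2)))
    (c1.mul (c2.mul (Complex.continuous_conj.comp c3))) ?_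
  refine HasCompactSupport.intro (hs.prod (ht.prod ht)) ?_
  rintro ⟨x, ξ, η⟩ hx
  by_contra h
  rw [Function.uncurry_apply_pair] at h
  have h5 := right_ne_zero_of_mul h
  refine hx ⟨hκs x (left_ne_zero_of_mul h), hPt x ξ (left_ne_zero_of_mul h5), hPt x η ?_⟩
  intro h0
  exact right_ne_zero_of_mul h5 (by simp [h0])

lemma kernel_square_expansion (ha : HormClass (-(n : ℝ)) 0 δ a) (hψ : LPcut C₀ ψ)
    {χ : Rn n → ℝ} (hχ : Continuous χ) {R : ℝ} (hχR : ∀ x, χ x ≠ 0 → ‖x‖ ≤ R)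
    {lam : ℝ} (hlam : 0 < lam) (x₀ y : Rn n) :
    ∫ x : Rn n, ((χ (x - x₀) : ℝ) : ℂ) * ((‖∫ ξ : Rn n,
        Complex.exp (Complex.I * ((⟪x - y, ξ⟫_ℝ : ℝ) : ℂ)) * locSymbol a ψ lam x ξ‖ ^ 2 : ℝ) : ℂ) =
    ∫ z : Rn n × Rn n, Complex.exp (-(Complex.I * ((⟪y, z.1 - z.2⟫_ℝ : ℝ) : ℂ))) *
      ∫ x : Rn n, Complex.exp (Complex.I * ((⟪x, z.1 - z.2⟫_ℝ : ℝ) : ℂ)) *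
        (((χ (x - x₀) : ℝ) : ℂ) * (locSymbol a ψ lam x z.1 *
          (starRingEnd ℂ) (locSymbol a ψ lam x z.2))) := by
  set P : Rn n → Rn n → ℂ := fun x ξ =>
    Complex.exp (Complex.I * ((⟪x - y, ξ⟫_ℝ : ℝ) : ℂ)) * locSymbol a ψ lam x ξ with hP
  have hc := continuous_locSymbol ha hψ lam
  have hPc : Continuous (fun q : Rn n × Rn n => P q.1 q.2) := by
    refine Continuous.mul ?_ hc
    fun_prop
  have hP0 : ∀ x ξ, P x ξ ≠ 0 → ξ ∈ Metric.closedBall (0 : Rn n) (2 * C₀ * lam) := by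
    intro x ξ h
    exact locSymbol_eq_zero hψ hlam x (right_ne_zero_of_mul h)
  have h3 : ∀ x (z : Rn n × Rn n),
      ((χ (x - x₀) : ℝ) : ℂ) * (P x z.1 * (starRingEnd ℂ) (P x z.2)) =
      Complex.exp (-(Complex.I * ((⟪y, z.1 - z.2⟫_ℝ : ℝ) : ℂ))) *
      (Complex.exp (Complex.I * ((⟪x, z.1 - z.2⟫_ℝ : ℝ) : ℂ)) *
        (((χ (x - x₀) : ℝ) : ℂ) * (locSymbol a ψ lam x z.1 *
          (starRingEnd ℂ) (locSymbol a ψ lam x z.2)))) := by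
    intro x z
    simp only [hP, map_mul, ← Complex.exp_conj, Complex.conj_I, Complex.conj_ofReal]
    have h4 : Complex.exp (Complex.I * ((⟪x - y, z.1⟫_ℝ : ℝ) : ℂ)) *
        Complex.exp (-Complex.I * ((⟪x - y, z.2⟫_ℝ : ℝ) : ℂ)) =
        Complex.exp (-(Complex.I * ((⟪y, z.1 - z.2⟫_ℝ : ℝ) : ℂ))) *
        Complex.exp (Complex.I * ((⟪x, z.1 - z.2⟫_ℝ : ℝ) : ℂ)) := by
      rw [← Complex.exp_add, ← Complex.exp_add]
      congr 1
      simp only [inner_sub_left, inner_sub_right]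
      push_cast
      ring
    linear_combination (((χ (x - x₀) : ℝ) : ℂ) * (locSymbol a ψ lam x z.1 *
          (starRingEnd ℂ) (locSymbol a ψ lam x z.2))) * h4
  have hκ : Continuous fun x => ((χ (x - x₀) : ℝ) : ℂ) :=
    Complex.continuous_ofReal.comp (hχ.comp (continuous_id.sub continuous_const))
  rw [integral_mul_norm_integral_sq hκ hPc (isCompact_closedBall x₀ R)
    (isCompact_closedBall (0 : Rn n) (2 * C₀ * lam)) (fun x hx => by
      rw [Metric.mem_closedBall, dist_eq_norm]
      exact hχR _ (by simpa using hx)) hP0]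
  congr 1; ext z
  rw [← integral_const_mul]
  congr 1; ext x
  exact h3 x z

/-- Local square-integrability of the dyadic kernels in the output variable. -/
lemma Kj_local_L2 (hC₀ : 1 < C₀) (hδ0 : 0 ≤ δ)
    (ha : HormClass (-(n : ℝ)) 0 δ a) (hψ : LPcut C₀ ψ)
    {χ : Rn n → ℝ} (hχ : ContDiff ℝ (⊤ : ℕ∞) χ) {R : ℝ} (hR : 0 ≤ R)
    (hχR : ∀ x, χ x ≠ 0 → ‖x‖ ≤ R) (hχ0 : ∀ x, 0 ≤ χ x) :
    ∃ C : ℝ, 0 < C ∧ ∀ (j : ℕ) (x₀ y : Rn n),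
      ∫ x : Rn n, χ (x - x₀) * ‖Kj a ψ j x y‖ ^ 2 ≤ C * ((2 : ℝ) ^ j) ^ (-((n : ℝ) * (1 - δ))) := by
  obtain ⟨B, hB, hb⟩ := frequency_interaction_decay hC₀ hδ0 ha hψ hχ hR hχR
  obtain ⟨I, hI, hprof⟩ := lintegral_profile n
  set V : ℝ := volume.real (Metric.ball (0 : Rn n) 1) with hV
  have hV0 : 0 ≤ V := measureReal_nonneg
  refine ⟨B * (I + 1) * ((2 * C₀) ^ n * (V + 1)), by positivity, fun j x₀ y => ?_⟩
  set lam : ℝ := 2 ^ j with hlam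
  have hl : 1 ≤ lam := one_le_pow₀ (by norm_num)
  have hl0 : 0 < lam := by positivity
  set N : ℝ := lam ^ (-(n : ℝ)) with hN
  have hN0 : 0 < N := by positivity
  set S : Rn n → ℂ := fun x => ∫ ξ : Rn n,
        Complex.exp (Complex.I * ((⟪x - y, ξ⟫_ℝ : ℝ) : ℂ)) * locSymbol a ψ lam x ξ with hS
  set U : ℝ := ∫ x : Rn n, χ (x - x₀) * ‖S x‖ ^ 2 with hU
  have hmono : ∫ x : Rn n, χ (x - x₀) * ‖Kj a ψ j x y‖ ^ 2 ≤ U := by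
    have h1 : ∀ x, χ (x - x₀) * ‖Kj a ψ j x y‖ ^ 2 =
        ‖((((2 * π) ^ n)⁻¹ : ℝ) : ℂ)‖ ^ 2 * (χ (x - x₀) * ‖S x‖ ^ 2) := by
      intro x
      rw [Kj_eq, norm_mul, mul_pow]
      ring
    simp only [h1]
    rw [integral_const_mul]
    refine mul_le_of_le_one_left (integral_nonneg fun x => ?_) ?_
    · exact mul_nonneg (hχ0 _) (by positivity)
    · exact pow_le_one₀ (norm_nonneg _) (norm_kernel_const_le_one n)
  refine hmono.trans ?_
  have hUC : ((U : ℝ) : ℂ) = ∫ x : Rn n, ((χ (x - x₀) : ℝ) : ℂ) * ((‖S x‖ ^ 2 : ℝ) : ℂ) := by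
    rw [hU, ← integral_complex_ofReal]
    congr 1; ext x
    push_cast
    rfl
  set ρ : ℝ := 2 * C₀ * lam with hρ
  set G : Rn n × Rn n → ℝ≥0∞ := fun z =>
    Set.indicator (Metric.closedBall (0 : Rn n) ρ) (fun _ => (1 : ℝ≥0∞)) z.1 *
      (ENNReal.ofReal (B * N * N) *
        ENNReal.ofReal (((1 + ‖z.1 - z.2‖ / lam ^ δ) ^ (n + 1))⁻¹)) with hG
  have hle : ‖((U : ℝ) : ℂ)‖ₑ ≤ ∫⁻ z, G z := by
    rw [hUC, kernel_square_expansion ha hψ hχ.continuous hχR hl0 x₀ y]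
    refine (enorm_integral_le_lintegral_enorm _).trans (lintegral_mono fun z => ?_)
    obtain ⟨ξ, η⟩ := z
    by_cases hξ : ξ ∈ Metric.closedBall (0 : Rn n) ρ
    · simp only [hG, Set.indicator_of_mem hξ, one_mul]
      rw [← ENNReal.ofReal_mul (by positivity), ← ofReal_norm]
      apply ENNReal.ofReal_le_ofReal
      rw [norm_mul, ← mul_neg, ← Complex.ofReal_neg, mul_comm Complex.I,
        Complex.norm_exp_ofReal_mul_I, one_mul]
      exact hb lam hl x₀ ξ η
    · have h0 : ∀ x, locSymbol a ψ lam x ξ = 0 := by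
        intro x
        by_contra h
        exact hξ (locSymbol_eq_zero hψ hl0 x h)
      simp [h0]
  have hGint : ∫⁻ z, G z ≤
      ENNReal.ofReal (ρ ^ n * V * (B * N * N * ((lam ^ δ) ^ n * I))) := by
    have hGm : Measurable G := by
      refine Measurable.mul ?_ (Measurable.const_mul ?_ _)
      · exact (measurable_const.indicator Metric.isClosed_closedBall.measurableSet).comp
          measurable_fst
      · exact ENNReal.measurable_ofReal.comp (by fun_prop)
    rw [Measure.volume_eq_prod, lintegral_prod _ hGm.aemeasurable]
    have h1 : ∀ ξ : Rn n, ∫⁻ η : Rn n, G (ξ, η) =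
        Set.indicator (Metric.closedBall (0 : Rn n) ρ) (fun _ => (1 : ℝ≥0∞)) ξ *
        (ENNReal.ofReal (B * N * N * ((lam ^ δ) ^ n * I))) := by
      intro ξ
      simp only [hG]
      rw [lintegral_const_mul _ (by fun_prop), lintegral_const_mul _ (by fun_prop)]
      rw [lintegral_sub_left_eq_self (μ := (volume : Measure (Rn n)))
        (fun v => ENNReal.ofReal (((1 + ‖v‖ / lam ^ δ) ^ (n + 1))⁻¹)) ξ, hprof _ (by positivity),
        ← ENNReal.ofReal_mul (by positivity)]
    simp only [h1]
    rw [lintegral_mul_const _ (measurable_const.indicator Metric.isClosed_closedBall.measurableSet),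
      lintegral_indicator_const Metric.isClosed_closedBall.measurableSet, one_mul]
    rw [← ENNReal.ofReal_toReal (measure_closedBall_lt_top (μ := (volume : Measure (Rn n)))
      (x := 0) (r := ρ)).ne, ← measureReal_def, Measure.addHaar_real_closedBall _ _ (by positivity),
      ← ENNReal.ofReal_mul (by positivity)]
    simp [hV]
  have hU0 : 0 ≤ U := integral_nonneg fun x => mul_nonneg (hχ0 _) (by positivity)
  have hfin := hle.trans hGint
  rw [← ofReal_norm, ENNReal.ofReal_le_ofReal_iff (by positivity), Complex.norm_real,
    Real.norm_of_nonneg hU0] at hfin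
  refine hfin.trans ?_
  have hpow : lam ^ (-((n : ℝ) * (1 - δ))) = N * (lam ^ δ) ^ n := by
    rw [hN, ← Real.rpow_natCast (lam ^ δ), ← Real.rpow_mul hl0.le, ← Real.rpow_add hl0]
    congr 1
    ring
  rw [hpow]
  have hNl : N * lam ^ n = 1 := rpow_neg_natCast_mul_pow hl0 n
  have hA : 0 < B * (2 * C₀) ^ n * (N * (lam ^ δ) ^ n) := by positivity
  calc ρ ^ n * V * (B * N * N * ((lam ^ δ) ^ n * I))
      = B * (2 * C₀) ^ n * (N * (lam ^ δ) ^ n) * (N * lam ^ n) * (I * V) := by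
        rw [hρ, mul_pow _ lam]; ring
    _ = B * (2 * C₀) ^ n * (N * (lam ^ δ) ^ n) * (I * V) := by rw [hNl, mul_one]
    _ ≤ B * (2 * C₀) ^ n * (N * (lam ^ δ) ^ n) * ((I + 1) * (V + 1)) := by
        apply mul_le_mul_of_nonneg_left _ hA.le
        nlinarith
    _ = _ := by ring

end Kernel

section Maximal

variable {n : ℕ}

lemma isClosed_cube (x₀ : Rn n) (l : ℝ) : IsClosed (cube x₀ l) := by
  have : cube x₀ l = ⋂ i, {y : Rn n | |y i - x₀ i| ≤ l / 2} := by
    ext y; simp [cube]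
  rw [this]
  exact isClosed_iInter fun i => isClosed_le (by fun_prop) continuous_const

lemma volume_cube (x₀ : Rn n) {l : ℝ} (hl : 0 ≤ l) :
    volume (cube x₀ l) = ENNReal.ofReal (l ^ n) := by
  have h : cube x₀ l = (WithLp.ofLp : Rn n → (Fin n → ℝ)) ⁻¹'
      (Set.pi Set.univ fun i => Set.Icc (x₀ i - l / 2) (x₀ i + l / 2)) := by
    ext y
    simp only [cube, Set.mem_ofPred_eq, Set.mem_preimage, Set.mem_pi, Set.mem_univ, true_implies,
      Set.mem_Icc, abs_le]
    refine forall_congr' fun i => ?_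
    constructor <;> rintro ⟨h1, h2⟩ <;> constructor <;> linarith
  rw [h, (PiLp.volume_preserving_ofLp (Fin n)).measure_preimage
    (MeasurableSet.univ_pi fun i => measurableSet_Icc).nullMeasurableSet, volume_pi_pi]
  have hlen : ∀ i, x₀ i + l / 2 - (x₀ i - l / 2) = l := fun i => by ring
  simp only [Real.volume_Icc, hlen]
  rw [Finset.prod_const, ENNReal.ofReal_pow hl]
  simp

lemma norm_sub_le_of_mem_cube {x₀ x : Rn n} {l : ℝ} (hl : l ≤ 1) (hx : x ∈ cube x₀ l) :
    ‖x - x₀‖ ≤ n := by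
  apply abs_le_of_sq_le_sq' _ (Nat.cast_nonneg n) |>.2
  rw [EuclideanSpace.norm_sq_eq]
  calc ∑ i, ‖(x - x₀) i‖ ^ 2 ≤ ∑ _i : Fin n, (1 : ℝ) := by
        refine Finset.sum_le_sum fun i _ => ?_
        have h := hx i
        have h2 : ‖(x - x₀) i‖ ≤ 1 := by
          rw [PiLp.sub_apply, Real.norm_eq_abs]
          linarith
        exact pow_le_one₀ (norm_nonneg _) h2
    _ = n := by simp
    _ ≤ (n : ℝ) ^ 2 := by exact_mod_cast Nat.le_self_pow (by norm_num) n

lemma mem_cube_of_norm_sub_le {x₀ x : Rn n} {l : ℝ} (h : ‖x - x₀‖ ≤ l / 2) : x ∈ cube x₀ l := by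
  intro i
  have := PiLp.norm_apply_le (x - x₀) i
  rw [PiLp.sub_apply, Real.norm_eq_abs] at this
  exact this.trans h

lemma setLIntegral_cube_le_mHL (u : Rn n → ℂ) (x₀ : Rn n) {l : ℝ} (hl : 0 < l) :
    ∫⁻ y in cube x₀ l, ‖u y‖ₑ ≤ ENNReal.ofReal (l ^ n) * mHL u x₀ := by
  have hmem : x₀ ∈ cube x₀ l := fun i => by simp; positivity
  have h : (∫⁻ y in cube x₀ l, ‖u y‖ₑ) / ENNReal.ofReal (l ^ n) ≤ mHL u x₀ :=
    le_iSup_of_le x₀ (le_iSup_of_le l (le_iSup_of_le hl (le_iSup_of_le hmem le_rfl)))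
  rw [ENNReal.div_le_iff (by simpa using pow_pos hl n) ENNReal.ofReal_ne_top] at h
  rwa [mul_comm]

/-- Integration against an integrable radial weight is controlled by the maximal function. -/
lemma lintegral_weight_le_mHL {u : Rn n → ℂ} (hu : Measurable u) (x₀ : Rn n) :
    ∫⁻ y, ENNReal.ofReal (((1 + ‖y - x₀‖) ^ (n + 1))⁻¹) * ‖u y‖ₑ ≤
      ENNReal.ofReal (4 ^ n * 2) * mHL u x₀ := by
  set w : ℕ → ℝ≥0∞ := fun k => ENNReal.ofReal ((((2 : ℝ) ^ k) ^ (n + 1))⁻¹) with hw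
  have hpt : ∀ y, ENNReal.ofReal (((1 + ‖y - x₀‖) ^ (n + 1))⁻¹) * ‖u y‖ₑ ≤
      ∑' k : ℕ, w k * (cube x₀ (2 ^ (k + 2))).indicator (fun y => ‖u y‖ₑ) y := by
    intro y
    obtain ⟨k, hk1, hk2⟩ := exists_nat_pow_near (x := 1 + ‖y - x₀‖) (y := (2 : ℝ))
      (by linarith [norm_nonneg (y - x₀)]) (by norm_num)
    refine le_trans ?_ (ENNReal.le_tsum k)
    have hmem : y ∈ cube x₀ (2 ^ (k + 2)) := by
      apply mem_cube_of_norm_sub_le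
      rw [pow_succ] at hk2 ⊢
      rw [pow_succ]
      linarith
    rw [Set.indicator_of_mem hmem]
    refine mul_le_mul_left ?_ _
    simp only [hw]
    apply ENNReal.ofReal_le_ofReal
    gcongr
  refine (lintegral_mono hpt).trans ?_
  have hm : ∀ k : ℕ, Measurable fun y => (cube x₀ (2 ^ (k + 2))).indicator (fun y => ‖u y‖ₑ) y :=
    fun k => hu.enorm.indicator (isClosed_cube _ _).measurableSet
  rw [lintegral_tsum fun k => ((hm k).const_mul _).aemeasurable]
  have hterm : ∀ k : ℕ,
      ∫⁻ y, w k * (cube x₀ (2 ^ (k + 2))).indicator (fun y => ‖u y‖ₑ) y ≤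
        ENNReal.ofReal (4 ^ n * (1 / 2) ^ k) * mHL u x₀ := by
    intro k
    rw [lintegral_const_mul _ (hm k), lintegral_indicator (isClosed_cube _ _).measurableSet]
    refine (mul_le_mul_right (setLIntegral_cube_le_mHL u x₀ (by positivity)) _).trans ?_
    rw [← mul_assoc, hw]
    simp only
    rw [← ENNReal.ofReal_mul (by positivity)]
    refine le_of_eq ?_
    congr 2
    have h2 : ((2 : ℝ) ^ (k + 2)) ^ n = (2 ^ k) ^ n * 4 ^ n := by
      rw [pow_add, mul_pow]; norm_num
    rw [h2, one_div, inv_pow, pow_succ]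
    field_simp
  refine (ENNReal.tsum_le_tsum hterm).trans ?_
  rw [ENNReal.tsum_mul_right, ← ENNReal.ofReal_tsum_of_nonneg (fun k => by positivity)
    (summable_geometric_two.mul_left _), tsum_mul_left, tsum_geometric_two]

end Maximal

lemma le_rpow_mul_rpow_of_le {z X Y t : ℝ} (hz : 0 ≤ z) (hX : z ≤ X) (hY : z ≤ Y)
    (ht0 : 0 ≤ t) (ht1 : t ≤ 1) : z ≤ X ^ (1 - t) * Y ^ t := by
  calc z = z ^ ((1 - t) + t) := by simp
    _ = z ^ (1 - t) * z ^ t := Real.rpow_add_of_nonneg hz (by linarith) ht0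
    _ ≤ _ := mul_le_mul (Real.rpow_le_rpow hz hX (by linarith)) (Real.rpow_le_rpow hz hY ht0)
      (Real.rpow_nonneg hz _) (Real.rpow_nonneg (hz.trans hX) _)

section Averages

variable {n : ℕ} {δ : ℝ} {a : Rn n → Rn n → ℂ} {C₀ : ℝ} {ψ : Rn n → ℝ}

lemma exists_smooth_cutoff (n : ℕ) : ∃ χ : Rn n → ℝ, ContDiff ℝ (⊤ : ℕ∞) χ ∧ (∀ x, 0 ≤ χ x) ∧
    (∀ x, χ x ≠ 0 → ‖x‖ ≤ (n : ℝ) + 2) ∧ ∀ x, ‖x‖ ≤ n → χ x = 1 := by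
  let χ : ContDiffBump (0 : Rn n) := ⟨n + 1, n + 2, by positivity, by linarith⟩
  refine ⟨χ, χ.contDiff, fun _ => χ.nonneg, fun x hx => ?_, fun x hx => ?_⟩
  · have h : x ∈ Function.support χ := hx
    rw [χ.support_eq, mem_ball_zero_iff] at h
    exact h.le
  · apply χ.one_of_mem_closedBall
    rw [mem_closedBall_zero_iff]
    change _ ≤ (n : ℝ) + 1
    linarith

/-- A weighted `L²` bound on a function controls its integral over a small cube. -/
lemma setLIntegral_cube_le_of_sq {K : Rn n → ℂ} (hK : Continuous K) {χ : Rn n → ℝ}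
    (hχ : Continuous χ) (hχ0 : ∀ x, 0 ≤ χ x) {R : ℝ} (hχR : ∀ x, χ x ≠ 0 → ‖x‖ ≤ R)
    (hχ1 : ∀ x, ‖x‖ ≤ n → χ x = 1) (x₀ : Rn n) {l : ℝ} (hl0 : 0 < l) (hl1 : l ≤ 1)
    {B : ℝ} (hB0 : 0 < B) :
    ∫⁻ x in cube x₀ l, ‖K x‖ₑ ≤
      ENNReal.ofReal (B⁻¹ * (∫ x, χ (x - x₀) * ‖K x‖ ^ 2) + B) := by
  have hχc : Continuous fun x => χ (x - x₀) := hχ.comp (by fun_prop)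
  have hInt : Integrable fun x => χ (x - x₀) * ‖K x‖ ^ 2 := by
    apply Continuous.integrable_of_hasCompactSupport
    · exact hχc.mul (hK.norm.pow 2)
    · refine HasCompactSupport.intro (isCompact_closedBall x₀ R) fun x hx => ?_
      have : χ (x - x₀) = 0 := by
        by_contra h0
        apply hx
        rw [Metric.mem_closedBall, dist_eq_norm]
        exact hχR _ h0
      rw [this, zero_mul]
  have hI : 0 ≤ ∫ x, χ (x - x₀) * ‖K x‖ ^ 2 :=
    integral_nonneg fun x => mul_nonneg (hχ0 _) (by positivity)
  have hpt : ∀ x ∈ cube x₀ l, ‖K x‖ₑ ≤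
      ENNReal.ofReal (B⁻¹ * (χ (x - x₀) * ‖K x‖ ^ 2)) + ENNReal.ofReal B := by
    intro x hx
    rw [hχ1 _ (norm_sub_le_of_mem_cube hl1 hx), one_mul, ← ofReal_norm,
      ← ENNReal.ofReal_add (by positivity) hB0.le]
    apply ENNReal.ofReal_le_ofReal
    have h2 : B⁻¹ * ‖K x‖ ^ 2 + B - ‖K x‖ =
        B⁻¹ * ((‖K x‖ - B / 2) ^ 2 + 3 / 4 * B ^ 2) := by
      field_simp
      ring
    have h3 : 0 ≤ B⁻¹ * ((‖K x‖ - B / 2) ^ 2 + 3 / 4 * B ^ 2) := by positivity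
    linarith
  have hcm := (isClosed_cube x₀ l).measurableSet
  refine (setLIntegral_mono' hcm hpt).trans ?_
  rw [lintegral_add_right _ measurable_const, setLIntegral_const, volume_cube x₀ hl0.le,
    ENNReal.ofReal_add (by positivity) hB0.le]
  refine add_le_add ?_ ?_
  · refine (setLIntegral_le_lintegral _ _).trans (le_of_eq ?_)
    rw [← ofReal_integral_eq_lintegral_ofReal (hInt.const_mul _)
      (Filter.Eventually.of_forall fun x =>
        mul_nonneg (by positivity) (mul_nonneg (hχ0 _) (by positivity))), integral_const_mul]
  · refine mul_le_of_le_one_right zero_le ?_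
    rw [ENNReal.ofReal_le_one]
    exact pow_le_one₀ hl0.le hl1

lemma Kj_cube_L1 (hC₀ : 1 < C₀) (hδ0 : 0 ≤ δ) (ha : HormClass (-(n : ℝ)) 0 δ a)
    (hψ : LPcut C₀ ψ) : ∃ C : ℝ, 0 < C ∧ ∀ (j : ℕ) (x₀ y : Rn n) (l : ℝ), 0 < l → l ≤ 1 →
      ∫⁻ x in cube x₀ l, ‖Kj a ψ j x y‖ₑ ≤
        ENNReal.ofReal (C * ((2 : ℝ) ^ j) ^ (-((n : ℝ) / 2 * (1 - δ)))) := by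
  obtain ⟨χ, hχ, hχ0, hχR, hχ1⟩ := exists_smooth_cutoff n
  obtain ⟨C, hC, h⟩ := Kj_local_L2 hC₀ hδ0 ha hψ hχ (by positivity) hχR hχ0
  refine ⟨C + 1, by positivity, fun j x₀ y l hl0 hl1 => ?_⟩
  have hlam0 : (0 : ℝ) < 2 ^ j := by positivity
  have hsq := h j x₀ y
  generalize hlam : (2 : ℝ) ^ j = lam at hlam0 hsq ⊢
  have hB0 : 0 < lam ^ (-((n : ℝ) / 2 * (1 - δ))) := by positivity
  have hBB : lam ^ (-((n : ℝ) * (1 - δ))) =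
      lam ^ (-((n : ℝ) / 2 * (1 - δ))) * lam ^ (-((n : ℝ) / 2 * (1 - δ))) := by
    rw [← Real.rpow_add hlam0]
    congr 1
    ring
  rw [hBB] at hsq
  generalize lam ^ (-((n : ℝ) / 2 * (1 - δ))) = B at hB0 hsq ⊢
  have hKc : Continuous fun x => Kj a ψ j x y :=
    (continuous_Kj ha hψ j).comp (g := fun z : Rn n × Rn n => Kj a ψ j z.1 z.2)
      (f := fun x : Rn n => (x, y)) (by fun_prop)
  refine (setLIntegral_cube_le_of_sq hKc hχ.continuous hχ0 hχR hχ1 x₀ hl0 hl1 hB0).trans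
    (ENNReal.ofReal_le_ofReal ?_)
  calc _ ≤ B⁻¹ * (C * (B * B)) + B :=
        add_le_add (mul_le_mul_of_nonneg_left hsq (by positivity)) le_rfl
    _ = (C + 1) * B := by
      field_simp

lemma Kj_cube_decay (hC₀ : 1 < C₀) (ha : HormClass (-(n : ℝ)) 0 δ a) (hψ : LPcut C₀ ψ) (M : ℕ) :
    ∃ C : ℝ, 0 < C ∧ ∀ (j : ℕ) (x₀ y : Rn n) (l : ℝ), 0 < l → l ≤ 1 →
      ∫⁻ x in cube x₀ l, ‖Kj a ψ j x y‖ₑ ≤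
        ENNReal.ofReal (C * ((1 + ‖y - x₀‖) ^ M)⁻¹ * l ^ n) := by
  obtain ⟨C, hC, h⟩ := Kj_decay hC₀ ha hψ M
  refine ⟨C * (1 + n) ^ M, by positivity, fun j x₀ y l hl0 hl1 => ?_⟩
  have hpt : ∀ x ∈ cube x₀ l, ‖Kj a ψ j x y‖ₑ ≤
      ENNReal.ofReal (C * (1 + n) ^ M * ((1 + ‖y - x₀‖) ^ M)⁻¹) := by
    intro x hx
    rw [← ofReal_norm]
    apply ENNReal.ofReal_le_ofReal
    rw [← div_eq_mul_inv, le_div_iff₀ (by positivity)]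
    have h1 := norm_sub_le_of_mem_cube hl1 hx
    have h2 : ‖y - x₀‖ ≤ ‖x - y‖ + ‖x - x₀‖ := by
      have := norm_sub_le (x - x₀) (x - y)
      rw [show x - x₀ - (x - y) = y - x₀ by abel] at this
      linarith
    have h3 : 1 + ‖y - x₀‖ ≤ (1 + ‖x - y‖) * (1 + n) := by
      nlinarith [norm_nonneg (x - y), (Nat.cast_nonneg n : (0 : ℝ) ≤ n)]
    calc ‖Kj a ψ j x y‖ * (1 + ‖y - x₀‖) ^ M
        ≤ ‖Kj a ψ j x y‖ * ((1 + ‖x - y‖) * (1 + n)) ^ M := by gcongr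
      _ = (1 + ‖x - y‖) ^ M * ‖Kj a ψ j x y‖ * (1 + n) ^ M := by rw [mul_pow]; ring
      _ ≤ _ := by
        gcongr
        exact h j x y
  refine (setLIntegral_mono' (isClosed_cube x₀ l).measurableSet hpt).trans ?_
  rw [setLIntegral_const, volume_cube x₀ hl0.le, ← ENNReal.ofReal_mul (by positivity)]

/-- Interpolation between the `L¹` bound and the off-diagonal decay of cube averages. -/
lemma Kj_cube_average (hn : 1 ≤ n) (hC₀ : 1 < C₀) (hδ0 : 0 ≤ δ)
    (ha : HormClass (-(n : ℝ)) 0 δ a) (hψ : LPcut C₀ ψ) {N : ℕ} (hN : n ≤ N) :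
    ∃ C : ℝ, 0 < C ∧ ∀ (j : ℕ) (x₀ y : Rn n) (l : ℝ), 0 < l → l ≤ 1 →
      (∫⁻ x in cube x₀ l, ‖Kj a ψ j x y‖ₑ) / ENNReal.ofReal (l ^ n) ≤
        ENNReal.ofReal (C * ((2 : ℝ) ^ j) ^ (-((1 - (n : ℝ) / N) * ((n : ℝ) / 2 * (1 - δ)))) *
          l ^ ((n : ℝ) ^ 2 / N - n) * ((1 + ‖y - x₀‖) ^ (n + 1))⁻¹) := by
  obtain ⟨A, hA, ha1⟩ := Kj_cube_L1 hC₀ hδ0 ha hψ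
  obtain ⟨D, hD, hd⟩ := Kj_cube_decay hC₀ ha hψ ((n + 1) * N)
  have hn0 : (0 : ℝ) < n := by exact_mod_cast hn
  have hN' : (n : ℝ) ≤ N := by exact_mod_cast hN
  have hN0 : (0 : ℝ) < N := by linarith
  set t : ℝ := (n : ℝ) / N with ht
  have ht0 : 0 ≤ t := by positivity
  have ht1 : t ≤ 1 := by rw [ht, div_le_one hN0]; exact hN'
  refine ⟨A ^ (1 - t) * D ^ t, by positivity, fun j x₀ y l hl0 hl1 => ?_⟩
  set lam : ℝ := 2 ^ j with hlam
  have hlam0 : 0 < lam := by positivity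
  set s : ℝ := 1 + ‖y - x₀‖ with hs
  have hs1 : 1 ≤ s := by rw [hs]; linarith [norm_nonneg (y - x₀)]
  have hs0 : 0 < s := by linarith
  have hln : 0 < l ^ n := by positivity
  set X : ℝ := A * lam ^ (-((n : ℝ) / 2 * (1 - δ))) * (l ^ n)⁻¹ with hX
  set Y : ℝ := D * (s ^ ((n + 1) * N))⁻¹ with hY
  have hX0 : 0 < X := by positivity
  have hY0 : 0 < Y := by positivity
  have h1 : (∫⁻ x in cube x₀ l, ‖Kj a ψ j x y‖ₑ) / ENNReal.ofReal (l ^ n) ≤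
      ENNReal.ofReal (min X Y) := by
    rw [ENNReal.div_le_iff (by simpa using hln) ENNReal.ofReal_ne_top,
      ← ENNReal.ofReal_mul (by positivity)]
    rcases min_choice X Y with h | h <;> rw [h]
    · refine (ha1 j x₀ y l hl0 hl1).trans (le_of_eq ?_)
      congr 1
      rw [hX, mul_assoc, inv_mul_cancel₀ hln.ne', mul_one]
    · exact hd j x₀ y l hl0 hl1
  refine h1.trans (ENNReal.ofReal_le_ofReal ?_)
  refine (le_rpow_mul_rpow_of_le (by positivity) (min_le_left X Y) (min_le_right X Y)
    ht0 ht1).trans ?_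
  have hXt : X ^ (1 - t) = A ^ (1 - t) * lam ^ (-((1 - t) * ((n : ℝ) / 2 * (1 - δ)))) *
      l ^ ((n : ℝ) ^ 2 / N - n) := by
    rw [hX, Real.mul_rpow (by positivity) (by positivity), Real.mul_rpow hA.le (by positivity),
      ← Real.rpow_mul hlam0.le, ← Real.rpow_natCast l, ← Real.rpow_neg hl0.le,
      ← Real.rpow_mul hl0.le]
    congr 2
    · congr 1; ring
    · rw [ht]; ring
  have hYt : Y ^ t ≤ D ^ t * (s ^ (n + 1))⁻¹ := by
    rw [hY, Real.mul_rpow hD.le (by positivity), Real.inv_rpow (by positivity)]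
    gcongr
    rw [← Real.rpow_natCast s ((n + 1) * N), ← Real.rpow_mul hs0.le, ← Real.rpow_natCast]
    apply Real.rpow_le_rpow_of_exponent_le hs1
    rw [ht]
    push_cast
    have h2 : ((n : ℝ) + 1) * N * (n / N) = (n + 1) * n := by field_simp
    rw [h2]
    have : (1 : ℝ) ≤ n := by exact_mod_cast hn
    nlinarith
  calc X ^ (1 - t) * Y ^ t ≤ X ^ (1 - t) * (D ^ t * (s ^ (n + 1))⁻¹) := by gcongr
    _ = _ := by rw [hXt]; ring

end Averages

lemma setLIntegral_enorm_integral_mul_le {n : ℕ} {K : Rn n → Rn n → ℂ}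
    (hK : Measurable fun z : Rn n × Rn n => ‖K z.1 z.2‖ₑ) {u : Rn n → ℂ} (hu : Measurable u)
    (s : Set (Rn n)) :
    ∫⁻ x in s, ‖∫ y, K x y * u y‖ₑ ≤ ∫⁻ y, (∫⁻ x in s, ‖K x y‖ₑ) * ‖u y‖ₑ := by
  have hm : Measurable fun z : Rn n × Rn n => ‖u z.2‖ₑ := (hu.comp measurable_snd).enorm
  calc _ ≤ ∫⁻ x in s, ∫⁻ y, ‖K x y‖ₑ * ‖u y‖ₑ := by
        refine lintegral_mono fun x => ?_
        refine (enorm_integral_le_lintegral_enorm _).trans (le_of_eq ?_)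
        simp only [enorm_mul]
    _ = ∫⁻ y, ∫⁻ x in s, ‖K x y‖ₑ * ‖u y‖ₑ := by
        refine lintegral_lintegral_swap (f := fun x y => ‖K x y‖ₑ * ‖u y‖ₑ) ?_
        exact (hK.mul hm).aemeasurable
    _ = _ := by
        refine lintegral_congr fun y => ?_
        refine lintegral_mul_const _ ?_
        exact hK.comp (g := fun z : Rn n × Rn n => ‖K z.1 z.2‖ₑ) (f := fun x : Rn n => (x, y))
          (by fun_prop)

/-- Let `a ∈ S^{-n}_{0,δ}` with `0 ≤ δ < 1`, let `N_δ > 2n/(1-δ) + n` be an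
integer, let `θ₀` satisfy `max{0, (n/2)(1-δ) - nN_δ/(N_δ-n)} < θ₀ < (n/2)(1-δ) - n²/(N_δ-n)`,
and set `T_δ = -n²/N_δ + (1 - n/N_δ)((n/2)(1-δ) - θ₀)`. Then for `0 < l < 1` and `j ≥ 1` with
`2^j ≥ l^{-(n-n²/N_δ)/T_δ}`:
`|Q(x₀,l)|⁻¹ ∫_{Q(x₀,l)} |T_j u| dx ≤ C 2^{-jT_δ} l^{n²/N_δ - n} Mu(x₀)`. -/
theorem stmt13 (n : ℕ) (hn : 1 ≤ n) (δ : ℝ) (hδ0 : 0 ≤ δ) (hδ1 : δ < 1)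
    (a : Rn n → Rn n → ℂ) (ha : HormClass (-(n : ℝ)) 0 δ a)
    (C₀ : ℝ) (hC₀ : 1 < C₀) (ψ : Rn n → ℝ) (hψ : LPcut C₀ ψ)
    (Nδ : ℕ) (hNδ : 2 * (n : ℝ) / (1 - δ) + n < (Nδ : ℝ))
    (θ₀ : ℝ)
    (hθ₀l : max 0 (((n : ℝ) / 2) * (1 - δ) - (n : ℝ) * Nδ / ((Nδ : ℝ) - n)) < θ₀)
    (hθ₀r : θ₀ < ((n : ℝ) / 2) * (1 - δ) - (n : ℝ) ^ 2 / ((Nδ : ℝ) - n))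
    (Tδ : ℝ)
    (hTδ : Tδ = -(n : ℝ) ^ 2 / Nδ + (1 - (n : ℝ) / Nδ) * (((n : ℝ) / 2) * (1 - δ) - θ₀)) :
    ∃ C : ℝ, 0 < C ∧ ∀ l : ℝ, 0 < l → l < 1 → ∀ x₀ : Rn n, ∀ j : ℕ, 1 ≤ j →
      l ^ (-(((n : ℝ) - (n : ℝ) ^ 2 / Nδ) / Tδ)) ≤ (2 : ℝ) ^ j →
      ∀ u : SchwartzMap (Rn n) ℂ,
        (∫⁻ x in cube x₀ l, (‖Tj a ψ j (⇑u) x‖₊ : ℝ≥0∞)) / ENNReal.ofReal (l ^ n) ≤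
          ENNReal.ofReal (C * (2 : ℝ) ^ (-((j : ℝ) * Tδ)) * l ^ ((n : ℝ) ^ 2 / Nδ - n)) *
            mHL (⇑u) x₀ := by
  have hn0 : (0 : ℝ) < n := by exact_mod_cast hn
  have hδ' : 0 < 1 - δ := by linarith
  have hnN' : (n : ℝ) < Nδ := by
    have : 0 < 2 * (n : ℝ) / (1 - δ) := by positivity
    linarith
  have hN0 : (0 : ℝ) < Nδ := by linarith
  have hnN : n ≤ Nδ := by exact_mod_cast hnN'.le
  have hθ : 0 < θ₀ := lt_of_le_of_lt (le_max_left _ _) hθ₀l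
  have ht1 : 0 ≤ 1 - (n : ℝ) / Nδ := by
    rw [sub_nonneg, div_le_one hN0]; exact hnN'.le
  have hT : Tδ ≤ (1 - (n : ℝ) / Nδ) * ((n : ℝ) / 2 * (1 - δ)) := by
    have h1 : 0 ≤ (n : ℝ) ^ 2 / Nδ := by positivity
    have h2 : 0 ≤ (1 - (n : ℝ) / Nδ) * θ₀ := mul_nonneg ht1 hθ.le
    rw [hTδ, neg_div]
    nlinarith
  obtain ⟨C, hC, h⟩ := Kj_cube_average hn hC₀ hδ0 ha hψ hnN
  refine ⟨C * (4 ^ n * 2), by positivity, ?_⟩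
  intro l hl0 hl1 x₀ j _ _ u
  set H : ℝ := C * (2 : ℝ) ^ (-((j : ℝ) * Tδ)) * l ^ ((n : ℝ) ^ 2 / Nδ - n) with hH
  have hH0 : 0 ≤ H := by positivity
  have hpow : ((2 : ℝ) ^ j) ^ (-((1 - (n : ℝ) / Nδ) * ((n : ℝ) / 2 * (1 - δ)))) ≤
      (2 : ℝ) ^ (-((j : ℝ) * Tδ)) := by
    rw [← Real.rpow_natCast, ← Real.rpow_mul (by norm_num)]
    apply Real.rpow_le_rpow_of_exponent_le (by norm_num)
    rw [mul_neg, neg_le_neg_iff]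
    exact mul_le_mul_of_nonneg_left hT (Nat.cast_nonneg j)
  have hK := continuous_Kj ha hψ j
  have hu : Measurable (u : Rn n → ℂ) := u.continuous.measurable
  have hKm : Measurable fun z : Rn n × Rn n => ‖Kj a ψ j z.1 z.2‖ₑ := hK.enorm.measurable
  have hTj : ∫⁻ x in cube x₀ l, ‖Tj a ψ j (⇑u) x‖ₑ ≤
      ∫⁻ y, (∫⁻ x in cube x₀ l, ‖Kj a ψ j x y‖ₑ) * ‖u y‖ₑ :=
    setLIntegral_enorm_integral_mul_le hKm hu _
  calc (∫⁻ x in cube x₀ l, ‖Tj a ψ j (⇑u) x‖ₑ) / ENNReal.ofReal (l ^ n)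
      ≤ (∫⁻ y, (∫⁻ x in cube x₀ l, ‖Kj a ψ j x y‖ₑ) * ‖u y‖ₑ) / ENNReal.ofReal (l ^ n) :=
        ENNReal.div_le_div_right hTj _
    _ = ∫⁻ y, (∫⁻ x in cube x₀ l, ‖Kj a ψ j x y‖ₑ) / ENNReal.ofReal (l ^ n) * ‖u y‖ₑ := by
        rw [div_eq_mul_inv, ← lintegral_mul_const' _ _
          (ENNReal.inv_ne_top.2 (by simpa using pow_pos hl0 n))]
        refine lintegral_congr fun y => ?_
        rw [div_eq_mul_inv]
        ring
    _ ≤ ∫⁻ y, ENNReal.ofReal H *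
          (ENNReal.ofReal (((1 + ‖y - x₀‖) ^ (n + 1))⁻¹) * ‖u y‖ₑ) := by
        refine lintegral_mono fun y => ?_
        rw [← mul_assoc, ← ENNReal.ofReal_mul hH0]
        refine mul_le_mul_left ((h j x₀ y l hl0 hl1.le).trans (ENNReal.ofReal_le_ofReal ?_)) _
        rw [hH]
        gcongr
    _ = ENNReal.ofReal H * ∫⁻ y, ENNReal.ofReal (((1 + ‖y - x₀‖) ^ (n + 1))⁻¹) * ‖u y‖ₑ :=
        lintegral_const_mul' _ _ ENNReal.ofReal_ne_top
    _ ≤ ENNReal.ofReal H * (ENNReal.ofReal (4 ^ n * 2) * mHL (⇑u) x₀) :=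
        mul_le_mul_right (lintegral_weight_le_mHL hu x₀) _
    _ = _ := by
        rw [← mul_assoc, ← ENNReal.ofReal_mul hH0, hH]
        congr 2
        ring
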